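/- arXiv:1307.1825 — 12 statements merged into one kernel-verified Lean document; each statement's English description precedes it below -/
import Mathlib

section
/- Let A and B be symmetric 2×2 real matrices. Then det A + det B + |(A*B - B*A) 0 1| ≤ (trace A)²/4 + (trace B)²/4, where (A*B - B*A) 0 1 denotes the (1,2)-entry of the commutator of A and B. -/
open Matrix

theorem wintgen_inequality_pointwise
    (A B : Matrix (Fin 2) (Fin 2) ℝ) (hA : A.IsSymm) (hB : B.IsSymm) :
    A.det + B.det + |(A * B - B * A) 0 1| ≤ A.trace ^ 2 / 4 + B.trace ^ 2 / 4 := by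
  have hA' : A 1 0 = A 0 1 := hA.apply 0 1
  have hB' : B 1 0 = B 0 1 := hB.apply 0 1
  simp only [det_fin_two, trace_fin_two, Matrix.sub_apply, mul_apply, Fin.sum_univ_two, hA', hB']
  rw [← le_sub_iff_add_le', abs_le]
  constructor
  · linarith [sq_nonneg ((A 0 0 - A 1 1) / 2 + B 0 1), sq_nonneg ((B 0 0 - B 1 1) / 2 - A 0 1)]
  · linarith [sq_nonneg ((A 0 0 - A 1 1) / 2 - B 0 1), sq_nonneg ((B 0 0 - B 1 1) / 2 + A 0 1)]
end

section
/- Let A and B be symmetric 2×2 real matrices with (A*B - B*A) 0 1 ≥ 0. Then det A + det B + (A*B - B*A) 0 1 = (trace A)²/4 + (trace B)²/4 holds if and only if there exist real numbers μ, γ, θ, φ such that, with R the rotation matrix ![![cos θ, -sin θ], ![sin θ, cos θ]], one has Rᵀ * (cos φ • A + sin φ • B) * R = ![![μ + 2γ, 0], ![0, μ]] and Rᵀ * (-sin φ • A + cos φ • B) * R = ![![0, γ], ![γ, 0]]. -/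
open Matrix Real

theorem exists_polar_coord (x y : ℝ) : ∃ r t : ℝ, x = r * Real.cos t ∧ y = r * Real.sin t := by
  refine ⟨‖(⟨x, y⟩ : ℂ)‖, Complex.arg ⟨x, y⟩, ?_, ?_⟩
  · rw [Complex.norm_mul_cos_arg]
  · rw [Complex.norm_mul_sin_arg]

/-- Equality holds in Wintgen's inequality iff the traceless parts of the two symmetric matrices
are orthogonal and of equal length, with the matching orientation. -/
theorem wintgen_equality_iff_traceless {A B : Matrix (Fin 2) (Fin 2) ℝ}
    (hA : A 1 0 = A 0 1) (hB : B 1 0 = B 0 1) :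
    A.det + B.det + (A * B - B * A) 0 1 = A.trace ^ 2 / 4 + B.trace ^ 2 / 4 ↔
      A 0 0 - A 1 1 = 2 * B 0 1 ∧ B 0 0 - B 1 1 = -2 * A 0 1 := by
  simp only [Matrix.det_fin_two, Matrix.trace_fin_two, Matrix.sub_apply, Matrix.mul_apply,
    Fin.sum_univ_two, hA, hB]
  constructor
  · intro h
    have hsum : (A 0 0 - A 1 1 - 2 * B 0 1) ^ 2 + (B 0 0 - B 1 1 + 2 * A 0 1) ^ 2 = 0 := by
      linear_combination -4 * h
    constructor
    · nlinarith [sq_nonneg (A 0 0 - A 1 1 - 2 * B 0 1), sq_nonneg (B 0 0 - B 1 1 + 2 * A 0 1)]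
    · nlinarith [sq_nonneg (A 0 0 - A 1 1 - 2 * B 0 1), sq_nonneg (B 0 0 - B 1 1 + 2 * A 0 1)]
  · rintro ⟨h₁, h₂⟩
    linear_combination (-(A 0 0 - A 1 1 - 2 * B 0 1) / 4) * h₁ -
      (B 0 0 - B 1 1 + 2 * A 0 1) / 4 * h₂

theorem rotation_mul_transpose (t : ℝ) :
    !![Real.cos t, -Real.sin t; Real.sin t, Real.cos t] *
      (!![Real.cos t, -Real.sin t; Real.sin t, Real.cos t])ᵀ = 1 := by
  have h := Real.cos_sq_add_sin_sq t
  ext i j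
  fin_cases i <;> fin_cases j <;> simp [Matrix.mul_apply, Fin.sum_univ_two]
  · linear_combination h
  · ring
  · ring
  · linear_combination h

theorem eq_conj_of_transpose_conj_eq {R X D : Matrix (Fin 2) (Fin 2) ℝ}
    (hR : R * Rᵀ = 1) (h : Rᵀ * X * R = D) : X = R * D * Rᵀ := by
  calc X = (R * Rᵀ) * X * (R * Rᵀ) := by rw [hR, one_mul, mul_one]
    _ = R * (Rᵀ * X * R) * Rᵀ := by simp only [Matrix.mul_assoc]
    _ = R * D * Rᵀ := by rw [h]

theorem wintgen_equality_case_nonneg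
    (A B : Matrix (Fin 2) (Fin 2) ℝ) (hA : A.IsSymm) (hB : B.IsSymm)
    (hKD : (A * B - B * A) 0 1 ≥ 0) :
    A.det + B.det + (A * B - B * A) 0 1 = A.trace ^ 2 / 4 + B.trace ^ 2 / 4 ↔
      ∃ μ γ θ φ : ℝ,
        (!![Real.cos θ, -Real.sin θ; Real.sin θ, Real.cos θ])ᵀ *
            (Real.cos φ • A + Real.sin φ • B) *
            !![Real.cos θ, -Real.sin θ; Real.sin θ, Real.cos θ] =
          !![μ + 2 * γ, 0; 0, μ] ∧
        (!![Real.cos θ, -Real.sin θ; Real.sin θ, Real.cos θ])ᵀ *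
            ((-Real.sin φ) • A + Real.cos φ • B) *
            !![Real.cos θ, -Real.sin θ; Real.sin θ, Real.cos θ] =
          !![0, γ; γ, 0] := by
  have hA' : A 1 0 = A 0 1 := hA.apply 0 1
  have hB' : B 1 0 = B 0 1 := hB.apply 0 1
  rw [wintgen_equality_iff_traceless hA' hB']
  constructor
  · rintro ⟨h₁, h₂⟩
    obtain ⟨ρ, φ, hm, hn⟩ := exists_polar_coord ((A 0 0 + A 1 1) / 2) ((B 0 0 + B 1 1) / 2)
    obtain ⟨γ, t, hx, hy⟩ := exists_polar_coord
      (B 0 1 * Real.cos φ - A 0 1 * Real.sin φ) (A 0 1 * Real.cos φ + B 0 1 * Real.sin φ)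
    obtain ⟨θ, rfl⟩ : ∃ θ, t = 2 * θ := ⟨t / 2, by ring⟩
    rw [Real.cos_two_mul'] at hx
    rw [Real.sin_two_mul] at hy
    have hφ := Real.cos_sq_add_sin_sq φ
    have hθ := Real.cos_sq_add_sin_sq θ
    have hX : Real.cos φ • A + Real.sin φ • B =
        !![ρ + γ * (Real.cos θ ^ 2 - Real.sin θ ^ 2), γ * (2 * Real.sin θ * Real.cos θ);
          γ * (2 * Real.sin θ * Real.cos θ), ρ - γ * (Real.cos θ ^ 2 - Real.sin θ ^ 2)] := by
      ext i j
      fin_cases i <;> fin_cases j <;> simp [hA', hB']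
      · linear_combination hx + Real.cos φ * hm + Real.sin φ * hn + ρ * hφ +
          Real.cos φ / 2 * h₁ + Real.sin φ / 2 * h₂
      · linear_combination hy
      · linear_combination hy
      · linear_combination -hx + Real.cos φ * hm + Real.sin φ * hn + ρ * hφ -
          Real.cos φ / 2 * h₁ - Real.sin φ / 2 * h₂
    have hY : (-Real.sin φ) • A + Real.cos φ • B =
        !![-(γ * (2 * Real.sin θ * Real.cos θ)), γ * (Real.cos θ ^ 2 - Real.sin θ ^ 2);
          γ * (Real.cos θ ^ 2 - Real.sin θ ^ 2), γ * (2 * Real.sin θ * Real.cos θ)] := by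
      ext i j
      fin_cases i <;> fin_cases j <;> simp [hA', hB']
      · linear_combination -hy - Real.sin φ * hm + Real.cos φ * hn -
          Real.sin φ / 2 * h₁ + Real.cos φ / 2 * h₂
      · linear_combination hx
      · linear_combination hx
      · linear_combination hy - Real.sin φ * hm + Real.cos φ * hn +
          Real.sin φ / 2 * h₁ - Real.cos φ / 2 * h₂
    refine ⟨ρ - γ, γ, θ, φ, ?_, ?_⟩
    · rw [hX]
      ext i j
      fin_cases i <;> fin_cases j <;> simp [Matrix.mul_apply, Fin.sum_univ_two]
      · linear_combination (ρ + γ * (Real.cos θ ^ 2 + Real.sin θ ^ 2 + 1)) * hθ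
      · ring
      · ring
      · linear_combination (ρ - γ * (Real.cos θ ^ 2 + Real.sin θ ^ 2 + 1)) * hθ
    · rw [hY]
      ext i j
      fin_cases i <;> fin_cases j <;> simp [Matrix.mul_apply, Fin.sum_univ_two]
      · ring
      · linear_combination γ * (Real.cos θ ^ 2 + Real.sin θ ^ 2 + 1) * hθ
      · linear_combination γ * (Real.cos θ ^ 2 + Real.sin θ ^ 2 + 1) * hθ
      · ring
  · rintro ⟨μ, γ, θ, φ, hX, hY⟩
    have hφ := Real.cos_sq_add_sin_sq φ
    have hX' := eq_conj_of_transpose_conj_eq (rotation_mul_transpose θ) hX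
    have hY' := eq_conj_of_transpose_conj_eq (rotation_mul_transpose θ) hY
    have hAeq : A = Real.cos φ • (Real.cos φ • A + Real.sin φ • B) -
        Real.sin φ • ((-Real.sin φ) • A + Real.cos φ • B) := by
      ext i j
      simp
      linear_combination -A i j * hφ
    have hBeq : B = Real.sin φ • (Real.cos φ • A + Real.sin φ • B) +
        Real.cos φ • ((-Real.sin φ) • A + Real.cos φ • B) := by
      ext i j
      simp
      linear_combination -B i j * hφ
    rw [hX', hY'] at hAeq hBeq
    rw [hAeq, hBeq]
    constructor <;> simp [Matrix.vecMul, dotProduct, Fin.sum_univ_two] <;> ring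
end

section
/- Let A and B be symmetric 2×2 real matrices with (A*B - B*A) 0 1 < 0. Then det A + det B + |(A*B - B*A) 0 1| = (trace A)²/4 + (trace B)²/4 holds if and only if there exist real numbers μ, γ, θ, φ such that, with R the rotation matrix ![![cos θ, -sin θ], ![sin θ, cos θ]], one has Rᵀ * (cos φ • A + sin φ • B) * R = ![![μ - 2γ, 0], ![0, μ]] and Rᵀ * (-sin φ • A + cos φ • B) * R = ![![0, γ], ![γ, 0]]. -/
open Matrix Real

/-- When the normal curvature is negative, equality in Wintgen's inequality means that the traceless
part of the second shape operator is the traceless part of the first rotated by a right angle. -/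
theorem wintgen_equality_iff (a b c d e f : ℝ) (h : a * e + b * f - (d * b + e * c) < 0) :
    (a * c - b * b) + (d * f - e * e) + |a * e + b * f - (d * b + e * c)| =
        (a + c) ^ 2 / 4 + (d + f) ^ 2 / 4 ↔
      a - c + 2 * e = 0 ∧ d - f - 2 * b = 0 := by
  rw [abs_of_neg h]
  constructor
  · intro H
    have hs : (a - c + 2 * e) ^ 2 + (d - f - 2 * b) ^ 2 = 0 := by linarith
    constructor <;> nlinarith [sq_nonneg (a - c + 2 * e), sq_nonneg (d - f - 2 * b)]
  · rintro ⟨h₁, h₂⟩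
    linear_combination (-(a - c + 2 * e) / 4) * h₁ - ((d - f - 2 * b) / 4) * h₂

theorem exists_polar (x y : ℝ) : ∃ r t : ℝ, x = r * cos t ∧ y = r * sin t :=
  ⟨‖(⟨x, y⟩ : ℂ)‖, Complex.arg ⟨x, y⟩,
    (Complex.norm_mul_cos_arg ⟨x, y⟩).symm, (Complex.norm_mul_sin_arg ⟨x, y⟩).symm⟩

/-- Conjugation of a symmetric matrix by a rotation, in coordinates. -/
theorem rotation_conj_eq_iff {u v : ℝ} (huv : u ^ 2 + v ^ 2 = 1) (a b c x y z : ℝ) :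
    !![u, -v; v, u]ᵀ * !![a, b; b, c] * !![u, -v; v, u] = !![x, y; y, z] ↔
      a = u ^ 2 * x - 2 * u * v * y + v ^ 2 * z ∧
      b = u * v * (x - z) + (u ^ 2 - v ^ 2) * y ∧
      c = v ^ 2 * x + 2 * u * v * y + u ^ 2 * z := by
  have hR : !![u, -v; v, u] * !![u, -v; v, u]ᵀ = 1 := by
    ext i j
    fin_cases i <;> fin_cases j <;> simp [Matrix.mul_apply, Fin.sum_univ_two] <;> linarith
  have hR' : !![u, -v; v, u]ᵀ * !![u, -v; v, u] = 1 := mul_eq_one_comm.mp hR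
  have hconj : !![u, -v; v, u]ᵀ * !![a, b; b, c] * !![u, -v; v, u] = !![x, y; y, z] ↔
      !![a, b; b, c] = !![u, -v; v, u] * !![x, y; y, z] * !![u, -v; v, u]ᵀ := by
    generalize !![u, -v; v, u] = R at hR hR'
    constructor
    · intro h
      rw [← h, ← Matrix.mul_assoc, ← Matrix.mul_assoc, hR, Matrix.one_mul, Matrix.mul_assoc, hR,
        Matrix.mul_one]
    · intro h
      rw [h, ← Matrix.mul_assoc, ← Matrix.mul_assoc, hR', Matrix.one_mul, Matrix.mul_assoc, hR',
        Matrix.mul_one]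
  have hmul : !![u, -v; v, u] * !![x, y; y, z] * !![u, -v; v, u]ᵀ =
      !![u ^ 2 * x - 2 * u * v * y + v ^ 2 * z, u * v * (x - z) + (u ^ 2 - v ^ 2) * y;
        u * v * (x - z) + (u ^ 2 - v ^ 2) * y, v ^ 2 * x + 2 * u * v * y + u ^ 2 * z] := by
    ext i j
    fin_cases i <;> fin_cases j <;> simp [Matrix.mul_apply, Fin.sum_univ_two] <;> ring
  rw [hconj, hmul]
  constructor
  · intro h
    exact ⟨congrFun (congrFun h 0) 0, congrFun (congrFun h 0) 1, congrFun (congrFun h 1) 1⟩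
  · rintro ⟨h₁, h₂, h₃⟩
    rw [← h₁, ← h₂, ← h₃]

theorem exists_eq_of_isSymm {A : Matrix (Fin 2) (Fin 2) ℝ} (hA : A.IsSymm) :
    ∃ a b c : ℝ, A = !![a, b; b, c] := by
  refine ⟨A 0 0, A 0 1, A 1 1, ?_⟩
  conv_lhs => rw [Matrix.eta_fin_two A, hA.apply 0 1]

theorem smul_add_smul_fin_two (s t a b c d e f : ℝ) :
    s • !![a, b; b, c] + t • !![d, e; e, f] =
      !![s * a + t * d, s * b + t * e; s * b + t * e, s * c + t * f] := by
  simp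

theorem wintgen_equality_case_neg
    (A B : Matrix (Fin 2) (Fin 2) ℝ) (hA : A.IsSymm) (hB : B.IsSymm)
    (hKD : (A * B - B * A) 0 1 < 0) :
    A.det + B.det + |(A * B - B * A) 0 1| = A.trace ^ 2 / 4 + B.trace ^ 2 / 4 ↔
      ∃ μ γ θ φ : ℝ,
        (!![Real.cos θ, -Real.sin θ; Real.sin θ, Real.cos θ])ᵀ *
            (Real.cos φ • A + Real.sin φ • B) *
            !![Real.cos θ, -Real.sin θ; Real.sin θ, Real.cos θ] =
          !![μ - 2 * γ, 0; 0, μ] ∧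
        (!![Real.cos θ, -Real.sin θ; Real.sin θ, Real.cos θ])ᵀ *
            ((-Real.sin φ) • A + Real.cos φ • B) *
            !![Real.cos θ, -Real.sin θ; Real.sin θ, Real.cos θ] =
          !![0, γ; γ, 0] := by
  obtain ⟨a, b, c, rfl⟩ := exists_eq_of_isSymm hA
  obtain ⟨d, e, f, rfl⟩ := exists_eq_of_isSymm hB
  have hcomm : (!![a, b; b, c] * !![d, e; e, f] - !![d, e; e, f] * !![a, b; b, c]) 0 1 =
      a * e + b * f - (d * b + e * c) := by
    simp
  rw [hcomm] at hKD
  simp only [hcomm, Matrix.det_fin_two_of, Matrix.trace_fin_two_of, smul_add_smul_fin_two,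
    rotation_conj_eq_iff (cos_sq_add_sin_sq _)]
  rw [wintgen_equality_iff a b c d e f hKD]
  constructor
  · rintro ⟨h₁, h₂⟩
    obtain ⟨ρ, φ, hh, hk⟩ := exists_polar ((a + c) / 2) ((d + f) / 2)
    obtain ⟨m, t, hp, hq⟩ := exists_polar (cos φ * ((a - c) / 2) + sin φ * b)
      (cos φ * b - sin φ * ((a - c) / 2))
    have hc : cos t = cos (t / 2) ^ 2 - sin (t / 2) ^ 2 := by
      rw [← cos_two_mul', mul_div_cancel₀ t two_ne_zero]
    have hs : sin t = 2 * sin (t / 2) * cos (t / 2) := by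
      rw [← sin_two_mul, mul_div_cancel₀ t two_ne_zero]
    have hθ := cos_sq_add_sin_sq (t / 2)
    have hφ := cos_sq_add_sin_sq φ
    rw [hc] at hp
    rw [hs] at hq
    have ha : a = ρ * cos φ + (a - c) / 2 := by linarith
    have hd : d = ρ * sin φ + b := by linarith
    have hf : f = ρ * sin φ - b := by linarith
    have hcc : c = ρ * cos φ - (a - c) / 2 := by linarith
    have he : e = -((a - c) / 2) := by linarith
    generalize (a - c) / 2 = p at *
    subst ha hd hf hcc he
    refine ⟨ρ - m, -m, t / 2, φ, ⟨?_, ?_, ?_⟩, ?_, ?_, ?_⟩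
    · linear_combination hp + ρ * hφ - ρ * hθ
    · linear_combination hq
    · linear_combination -hp + ρ * hφ - ρ * hθ
    · linear_combination hq
    · linear_combination -hp
    · linear_combination -hq
  · rintro ⟨μ, γ, θ, φ, ⟨h₁, h₂, h₃⟩, h₄, h₅, h₆⟩
    have hφ := cos_sq_add_sin_sq φ
    have hX : cos φ * (a - c + 2 * e) + sin φ * (d - f - 2 * b) = 0 := by
      linear_combination h₁ - h₃ + 2 * h₅
    have hY : cos φ * (d - f - 2 * b) - sin φ * (a - c + 2 * e) = 0 := by
      linear_combination h₄ - h₆ - 2 * h₂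
    constructor
    · linear_combination cos φ * hX - sin φ * hY - (a - c + 2 * e) * hφ
    · linear_combination sin φ * hX + cos φ * hY - (d - f - 2 * b) * hφ
end

section
/- Let A and B be symmetric 2×2 real matrices. Then (trace A)²/4 + (trace B)²/4 - det A - det B - (A*B - B*A) 0 1 ≥ 0, where (A*B - B*A) 0 1 denotes the (1,2)-entry of the commutator of A and B. -/
open Matrix

theorem wintgen_type_inequality_indefinite_pointwise
    (A B : Matrix (Fin 2) (Fin 2) ℝ) (hA : A.IsSymm) (hB : B.IsSymm) :
    A.trace ^ 2 / 4 + B.trace ^ 2 / 4 - A.det - B.det - (A * B - B * A) 0 1 ≥ 0 := by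
  have hA' : A 1 0 = A 0 1 := hA.apply 0 1
  have hB' : B 1 0 = B 0 1 := hB.apply 0 1
  simp only [trace_fin_two, det_fin_two, Matrix.sub_apply, Matrix.mul_apply,
    Fin.sum_univ_two, hA', hB']
  linarith [sq_nonneg ((A 0 0 - A 1 1) / 2 - B 0 1), sq_nonneg (A 0 1 + (B 0 0 - B 1 1) / 2)]
end

section
/- Define B : ℝ × ℝ → ℝ⁵ by B(s,t) = ( sinh(2s/√3) - t²/3 - (7/8 + t⁴/18)·e^{2s/√3}, t + (t³/3 - t/4)·e^{2s/√3}, 1/2 + (t²/2)·e^{2s/√3}, t + (t³/3 + t/4)·e^{2s/√3}, sinh(2s/√3) - t²/3 - (1/8 + t⁴/18)·e^{2s/√3} ). Then for all (s,t) ∈ ℝ², ⟨B(s,t), B(s,t)⟩ = -1, where ⟨x,y⟩ = -x₁y₁ - x₂y₂ - x₃y₃ + x₄y₄ + x₅y₅; that is, the image of B lies in the pseudo-hyperbolic space H⁴₂(-1). -/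
open Real

/-- The index-3 pseudo-Euclidean inner product on `ℝ⁵ = Fin 5 → ℝ`,
`⟨x,y⟩ = -x₁y₁ - x₂y₂ - x₃y₃ + x₄y₄ + x₅y₅`. -/
def innerE53 (x y : Fin 5 → ℝ) : ℝ :=
  -(x 0 * y 0) - x 1 * y 1 - x 2 * y 2 + x 3 * y 3 + x 4 * y 4

theorem image_lies_in_pseudo_hyperbolic_space
    (B : ℝ → ℝ → Fin 5 → ℝ)
    (hB : ∀ s t : ℝ, B s t =
      ![Real.sinh (2 * s / Real.sqrt 3) - t ^ 2 / 3 -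
          (7 / 8 + t ^ 4 / 18) * Real.exp (2 * s / Real.sqrt 3),
        t + (t ^ 3 / 3 - t / 4) * Real.exp (2 * s / Real.sqrt 3),
        1 / 2 + (t ^ 2 / 2) * Real.exp (2 * s / Real.sqrt 3),
        t + (t ^ 3 / 3 + t / 4) * Real.exp (2 * s / Real.sqrt 3),
        Real.sinh (2 * s / Real.sqrt 3) - t ^ 2 / 3 -
          (1 / 8 + t ^ 4 / 18) * Real.exp (2 * s / Real.sqrt 3)]) :
    ∀ s t : ℝ, innerE53 (B s t) (B s t) = -1 := by
  intro s t
  rw [hB]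
  simp only [innerE53, Matrix.cons_val, Real.sinh_eq]
  generalize 2 * s / Real.sqrt 3 = r
  have h : Real.exp r * Real.exp (-r) = 1 := by
    rw [← Real.exp_add, add_neg_cancel, Real.exp_zero]
  linear_combination (-3 / 4) * h
end

section
/- Define B : ℝ × ℝ → ℝ⁵ by B(s,t) = ( sinh(2s/√3) - t²/3 - (7/8 + t⁴/18)·e^{2s/√3}, t + (t³/3 - t/4)·e^{2s/√3}, 1/2 + (t²/2)·e^{2s/√3}, t + (t³/3 + t/4)·e^{2s/√3}, sinh(2s/√3) - t²/3 - (1/8 + t⁴/18)·e^{2s/√3} ). Then for all (s,t) ∈ ℝ², the partial derivatives of B satisfy ⟨∂B/∂s, ∂B/∂s⟩ = 1, ⟨∂B/∂s, ∂B/∂t⟩ = 0, and ⟨∂B/∂t, ∂B/∂t⟩ = e^{2s/√3}, where ⟨x,y⟩ = -x₁y₁ - x₂y₂ - x₃y₃ + x₄y₄ + x₅y₅; that is, B is a space-like isometric immersion whose induced metric is ds² + e^{2s/√3} dt², the metric of the hyperbolic plane H²(-1/3) of constant Gauss curvature -1/3. -/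
open Real

/-- The derivative of a coordinate of the form `a sinh(2s/c) + k + m exp(2s/c)` with respect to `s`. -/
lemma hasDerivAt_sinh_add_exp (a k m c s : ℝ) :
    HasDerivAt (fun u => a * Real.sinh (2 * u / c) + k + m * Real.exp (2 * u / c))
      (2 / c * (a * Real.cosh (2 * s / c) + m * Real.exp (2 * s / c))) s := by
  have h : HasDerivAt (fun u : ℝ => 2 * u / c) (2 / c) s := by
    simpa using ((hasDerivAt_id s).const_mul 2).div_const c
  refine (((h.sinh.const_mul a).add_const k).add (h.exp.const_mul m)).congr_deriv ?_
  ring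

/-- The derivative of a polynomial of degree four. -/
lemma hasDerivAt_quartic (a₀ a₁ a₂ a₃ a₄ t : ℝ) :
    HasDerivAt (fun v => a₀ + a₁ * v + a₂ * v ^ 2 + a₃ * v ^ 3 + a₄ * v ^ 4)
      (a₁ + 2 * a₂ * t + 3 * a₃ * t ^ 2 + 4 * a₄ * t ^ 3) t := by
  have h (n : ℕ) := hasDerivAt_pow n t
  refine ((((((hasDerivAt_id t).const_mul a₁).const_add a₀).add ((h 2).const_mul a₂)).add
    ((h 3).const_mul a₃)).add ((h 4).const_mul a₄)).congr_deriv ?_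
  norm_num
  ring

theorem spacelike_isometric_immersion_first_fundamental_form
    (B : ℝ → ℝ → Fin 5 → ℝ)
    (hB : ∀ s t : ℝ, B s t =
      ![Real.sinh (2 * s / Real.sqrt 3) - t ^ 2 / 3 -
          (7 / 8 + t ^ 4 / 18) * Real.exp (2 * s / Real.sqrt 3),
        t + (t ^ 3 / 3 - t / 4) * Real.exp (2 * s / Real.sqrt 3),
        1 / 2 + (t ^ 2 / 2) * Real.exp (2 * s / Real.sqrt 3),
        t + (t ^ 3 / 3 + t / 4) * Real.exp (2 * s / Real.sqrt 3),
        Real.sinh (2 * s / Real.sqrt 3) - t ^ 2 / 3 -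
          (1 / 8 + t ^ 4 / 18) * Real.exp (2 * s / Real.sqrt 3)]) :
    ∀ s t : ℝ,
      innerE53 (fun i => deriv (fun u => B u t i) s) (fun i => deriv (fun u => B u t i) s) = 1 ∧
      innerE53 (fun i => deriv (fun u => B u t i) s) (fun i => deriv (fun v => B s v i) t) = 0 ∧
      innerE53 (fun i => deriv (fun v => B s v i) t) (fun i => deriv (fun v => B s v i) t) =
        Real.exp (2 * s / Real.sqrt 3) := by
  intro s t
  set E := Real.exp (2 * s / Real.sqrt 3) with hE
  set a := 2 / Real.sqrt 3 with ha
  have ha2 : a ^ 2 = 4 / 3 := by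
    rw [ha, div_pow, Real.sq_sqrt (by norm_num)]
    norm_num
  set C := Real.cosh (2 * s / Real.sqrt 3) with hC
  have hCE : 2 * C * E = E ^ 2 + 1 := by
    have h : E * Real.exp (-(2 * s / Real.sqrt 3)) = 1 := by
      rw [hE, ← Real.exp_add, add_neg_cancel, Real.exp_zero]
    rw [hC, Real.cosh_eq, ← hE]
    linear_combination h
  have ds (i : Fin 5) (b k m : ℝ)
      (h : ∀ u, B u t i = b * Real.sinh (2 * u / Real.sqrt 3) + k +
        m * Real.exp (2 * u / Real.sqrt 3)) :
      deriv (fun u => B u t i) s = a * (b * C + m * E) := by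
    rw [funext h]
    exact (hasDerivAt_sinh_add_exp b k m _ s).deriv
  have dt (i : Fin 5) (a₀ a₁ a₂ a₃ a₄ : ℝ)
      (h : ∀ v, B s v i = a₀ + a₁ * v + a₂ * v ^ 2 + a₃ * v ^ 3 + a₄ * v ^ 4) :
      deriv (fun v => B s v i) t = a₁ + 2 * a₂ * t + 3 * a₃ * t ^ 2 + 4 * a₄ * t ^ 3 := by
    rw [funext h]
    exact (hasDerivAt_quartic a₀ a₁ a₂ a₃ a₄ t).deriv
  have s0 := ds 0 1 (-t ^ 2 / 3) (-(7 / 8 + t ^ 4 / 18)) fun u => by simp [hB]; ring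
  have s1 := ds 1 0 t (t ^ 3 / 3 - t / 4) fun u => by simp [hB]
  have s2 := ds 2 0 (1 / 2) (t ^ 2 / 2) fun u => by simp [hB]
  have s3 := ds 3 0 t (t ^ 3 / 3 + t / 4) fun u => by simp [hB]
  have s4 := ds 4 1 (-t ^ 2 / 3) (-(1 / 8 + t ^ 4 / 18)) fun u => by simp [hB]; ring
  have t0 := dt 0 (Real.sinh (2 * s / Real.sqrt 3) - 7 / 8 * E) 0 (-1 / 3) 0 (-E / 18)
    fun v => by simp [hB, ← hE]; ring
  have t1 := dt 1 0 (1 - E / 4) 0 (E / 3) 0 fun v => by simp [hB, ← hE]; ring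
  have t2 := dt 2 (1 / 2) 0 (E / 2) 0 0 fun v => by simp [hB, ← hE]; ring
  have t3 := dt 3 0 (1 + E / 4) 0 (E / 3) 0 fun v => by simp [hB, ← hE]; ring
  have t4 := dt 4 (Real.sinh (2 * s / Real.sqrt 3) - 1 / 8 * E) 0 (-1 / 3) 0 (-E / 18)
    fun v => by simp [hB, ← hE]; ring
  simp only [innerE53, s0, s1, s2, s3, s4, t0, t1, t2, t3, t4]
  refine ⟨?_, ?_, ?_⟩
  · linear_combination (3 / 4) * ha2 + (3 / 4) * a ^ 2 * hCE
  · ring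
  · ring
end

section
/- Define B : ℝ × ℝ → ℝ⁵ by B(s,t) = ( sinh(2s/√3) - t²/3 - (7/8 + t⁴/18)·e^{2s/√3}, t + (t³/3 - t/4)·e^{2s/√3}, 1/2 + (t²/2)·e^{2s/√3}, t + (t³/3 + t/4)·e^{2s/√3}, sinh(2s/√3) - t²/3 - (1/8 + t⁴/18)·e^{2s/√3} ). Then for all (s,t) ∈ ℝ², componentwise, ∂²B/∂s² + (1/√3)·∂B/∂s + e^{-2s/√3}·∂²B/∂t² = 2·B(s,t); that is, B satisfies ΔB = 2B, where Δ is the Laplace–Beltrami operator of the induced metric ds² + e^{2s/√3} dt². -/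
open Real

theorem hasDerivAt_const_add_exp_add_exp_neg (a b c k s : ℝ) :
    HasDerivAt (fun u => a + b * exp (k * u) + c * exp (-(k * u)))
      (0 + (k * b) * exp (k * s) + (-(k * c)) * exp (-(k * s))) s := by
  have h : HasDerivAt (fun u : ℝ => k * u) k s := by
    simpa using (hasDerivAt_id s).const_mul k
  refine (((h.exp.const_mul b).const_add a).add (h.neg.exp.const_mul c)).congr_deriv ?_
  simp only [Pi.neg_apply]
  ring

theorem iteratedDeriv_two_const_add_exp_add_exp_neg (a b c k s : ℝ) :
    iteratedDeriv 2 (fun u => a + b * exp (k * u) + c * exp (-(k * u))) s =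
      k ^ 2 * (b * exp (k * s) + c * exp (-(k * s))) := by
  rw [iteratedDeriv_succ, iteratedDeriv_one,
    funext fun u => (hasDerivAt_const_add_exp_add_exp_neg a b c k u).deriv,
    (hasDerivAt_const_add_exp_add_exp_neg 0 (k * b) (-(k * c)) k s).deriv]
  ring

theorem hasDerivAt_quartic_s8 (a b c d e t : ℝ) :
    HasDerivAt (fun v => a + b * v + c * v ^ 2 + d * v ^ 3 + e * v ^ 4)
      (b + (2 * c) * t + (3 * d) * t ^ 2 + (4 * e) * t ^ 3 + 0 * t ^ 4) t := by
  refine ((((((hasDerivAt_id t).const_mul b).const_add a).add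
    ((hasDerivAt_pow 2 t).const_mul c)).add ((hasDerivAt_pow 3 t).const_mul d)).add
    ((hasDerivAt_pow 4 t).const_mul e)).congr_deriv ?_
  simp
  ring

theorem iteratedDeriv_two_quartic (a b c d e t : ℝ) :
    iteratedDeriv 2 (fun v => a + b * v + c * v ^ 2 + d * v ^ 3 + e * v ^ 4) t =
      2 * c + 6 * d * t + 12 * e * t ^ 2 := by
  rw [iteratedDeriv_succ, iteratedDeriv_one,
    funext fun v => (hasDerivAt_quartic_s8 a b c d e v).deriv,
    (hasDerivAt_quartic_s8 b (2 * c) (3 * d) (4 * e) 0 t).deriv]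
  ring

/-- If `f` is `a + b e^{ks} + c e^{-ks}` in `s` and a quartic polynomial in `t`, with `k = 2 / √3`,
the eigenfunction equation reduces to an algebraic identity. -/
theorem laplace_eq_of_exp_of_quartic {f : ℝ → ℝ → ℝ} {s t : ℝ} (a b c p q r m n : ℝ)
    (hs : ∀ u, f u t = a + b * exp (2 / √3 * u) + c * exp (-(2 / √3 * u)))
    (ht : ∀ v, f s v = p + q * v + r * v ^ 2 + m * v ^ 3 + n * v ^ 4)
    (h : 2 * b * exp (2 / √3 * s) + 2 / 3 * c * exp (-(2 / √3 * s)) +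
      exp (-(2 / √3 * s)) * (2 * r + 6 * m * t + 12 * n * t ^ 2) = 2 * f s t) :
    iteratedDeriv 2 (fun u => f u t) s + (1 / √3) * deriv (fun u => f u t) s +
      exp (-(2 * s / √3)) * iteratedDeriv 2 (fun v => f s v) t = 2 * f s t := by
  rw [← h, funext hs, funext ht, iteratedDeriv_two_const_add_exp_add_exp_neg,
    (hasDerivAt_const_add_exp_add_exp_neg a b c _ s).deriv, iteratedDeriv_two_quartic,
    div_mul_eq_mul_div]
  have h3 : (2 / √3) ^ 2 = 4 / 3 := by
    rw [div_pow, sq_sqrt (by norm_num)]; norm_num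
  linear_combination (3 / 2 * b * exp (2 * s / √3) + 1 / 2 * c * exp (-(2 * s / √3))) * h3

theorem laplace_beltrami_eigenfunction_equation
    (B : ℝ → ℝ → Fin 5 → ℝ)
    (hB : ∀ s t : ℝ, B s t =
      ![Real.sinh (2 * s / Real.sqrt 3) - t ^ 2 / 3 -
          (7 / 8 + t ^ 4 / 18) * Real.exp (2 * s / Real.sqrt 3),
        t + (t ^ 3 / 3 - t / 4) * Real.exp (2 * s / Real.sqrt 3),
        1 / 2 + (t ^ 2 / 2) * Real.exp (2 * s / Real.sqrt 3),
        t + (t ^ 3 / 3 + t / 4) * Real.exp (2 * s / Real.sqrt 3),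
        Real.sinh (2 * s / Real.sqrt 3) - t ^ 2 / 3 -
          (1 / 8 + t ^ 4 / 18) * Real.exp (2 * s / Real.sqrt 3)]) :
    ∀ (s t : ℝ) (i : Fin 5),
      iteratedDeriv 2 (fun u => B u t i) s +
          (1 / Real.sqrt 3) * deriv (fun u => B u t i) s +
          Real.exp (-(2 * s / Real.sqrt 3)) * iteratedDeriv 2 (fun v => B s v i) t =
        2 * B s t i := by
  intro s t i
  have hE : exp (-(2 / √3 * s)) * exp (2 / √3 * s) = 1 := by
    rw [← exp_add, neg_add_cancel, exp_zero]
  fin_cases i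
  · refine laplace_eq_of_exp_of_quartic (f := fun s t => B s t 0)
      (-t ^ 2 / 3) (1 / 2 - (7 / 8 + t ^ 4 / 18)) (-1 / 2)
      (sinh (2 / √3 * s) - 7 / 8 * exp (2 / √3 * s)) 0 (-1 / 3) 0
      (-1 / 18 * exp (2 / √3 * s)) (fun u => ?_) (fun v => ?_) ?_
    · simp only [hB, mul_div_right_comm, sinh_eq, Fin.isValue, Matrix.cons_val]
      ring
    · simp only [hB, mul_div_right_comm, sinh_eq, Fin.isValue, Matrix.cons_val]
      ring
    · simp only [hB, mul_div_right_comm, sinh_eq, Fin.isValue, Matrix.cons_val]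
      linear_combination (-2 / 3 * t ^ 2) * hE
  · refine laplace_eq_of_exp_of_quartic (f := fun s t => B s t 1)
      t (t ^ 3 / 3 - t / 4) 0 0 (1 - 1 / 4 * exp (2 / √3 * s)) 0
      (1 / 3 * exp (2 / √3 * s)) 0 (fun u => ?_) (fun v => ?_) ?_
    · simp only [hB, mul_div_right_comm, sinh_eq, Fin.isValue, Matrix.cons_val]
      ring
    · simp only [hB, mul_div_right_comm, sinh_eq, Fin.isValue, Matrix.cons_val]
      ring
    · simp only [hB, mul_div_right_comm, sinh_eq, Fin.isValue, Matrix.cons_val]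
      linear_combination (2 * t) * hE
  · refine laplace_eq_of_exp_of_quartic (f := fun s t => B s t 2)
      (1 / 2) (t ^ 2 / 2) 0 (1 / 2) 0 (1 / 2 * exp (2 / √3 * s)) 0 0
      (fun u => ?_) (fun v => ?_) ?_
    · simp only [hB, mul_div_right_comm, sinh_eq, Fin.isValue, Matrix.cons_val]
      ring
    · simp only [hB, mul_div_right_comm, sinh_eq, Fin.isValue, Matrix.cons_val]
      ring
    · simp only [hB, mul_div_right_comm, sinh_eq, Fin.isValue, Matrix.cons_val]
      linear_combination (1) * hE
  · refine laplace_eq_of_exp_of_quartic (f := fun s t => B s t 3)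
      t (t ^ 3 / 3 + t / 4) 0 0 (1 + 1 / 4 * exp (2 / √3 * s)) 0
      (1 / 3 * exp (2 / √3 * s)) 0 (fun u => ?_) (fun v => ?_) ?_
    · simp only [hB, mul_div_right_comm, sinh_eq, Fin.isValue, Matrix.cons_val]
      ring
    · simp only [hB, mul_div_right_comm, sinh_eq, Fin.isValue, Matrix.cons_val]
      ring
    · simp only [hB, mul_div_right_comm, sinh_eq, Fin.isValue, Matrix.cons_val]
      linear_combination (2 * t) * hE
  · refine laplace_eq_of_exp_of_quartic (f := fun s t => B s t 4)
      (-t ^ 2 / 3) (1 / 2 - (1 / 8 + t ^ 4 / 18)) (-1 / 2)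
      (sinh (2 / √3 * s) - 1 / 8 * exp (2 / √3 * s)) 0 (-1 / 3) 0
      (-1 / 18 * exp (2 / √3 * s)) (fun u => ?_) (fun v => ?_) ?_
    · simp only [hB, mul_div_right_comm, sinh_eq, Fin.isValue, Matrix.cons_val]
      ring
    · simp only [hB, mul_div_right_comm, sinh_eq, Fin.isValue, Matrix.cons_val]
      ring
    · simp only [hB, mul_div_right_comm, sinh_eq, Fin.isValue, Matrix.cons_val]
      linear_combination (-2 / 3 * t ^ 2) * hE
end

section
/- Define ψ : ℝ × ℝ → ℝ⁵ by ψ(u,v) = (1/√2)·(cosh u, cosh v, 0, sinh u, sinh v). Then for all (u,v) ∈ ℝ²: (a) ⟨ψ(u,v), ψ(u,v)⟩ = -1, so the image of ψ lies in H⁴₂(-1); (b) ⟨∂ψ/∂u, ∂ψ/∂u⟩ = 1/2, ⟨∂ψ/∂u, ∂ψ/∂v⟩ = 0, and ⟨∂ψ/∂v, ∂ψ/∂v⟩ = 1/2, so the induced metric is the flat metric (du² + dv²)/2; (c) ∂²ψ/∂u² + ∂²ψ/∂v² = ψ, i.e. ψ satisfies Δψ = 2ψ for the Laplace–Beltrami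 operator of the induced flat metric, which expresses the minimality of the surface in H⁴₂(-1). Here ⟨x,y⟩ = -x₁y₁ - x₂y₂ - x₃y₃ + x₄y₄ + x₅y₅. -/
open Real

theorem flat_minimal_surface_in_H42
    (ψ : ℝ → ℝ → Fin 5 → ℝ)
    (hψ : ∀ u v : ℝ, ψ u v =
      ![(1 / Real.sqrt 2) * Real.cosh u, (1 / Real.sqrt 2) * Real.cosh v, 0,
        (1 / Real.sqrt 2) * Real.sinh u, (1 / Real.sqrt 2) * Real.sinh v]) :
    ∀ u v : ℝ,
      innerE53 (ψ u v) (ψ u v) = -1 ∧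
      (innerE53 (fun i => deriv (fun u' => ψ u' v i) u) (fun i => deriv (fun u' => ψ u' v i) u)
          = 1 / 2 ∧
        innerE53 (fun i => deriv (fun u' => ψ u' v i) u) (fun i => deriv (fun v' => ψ u v' i) v)
          = 0 ∧
        innerE53 (fun i => deriv (fun v' => ψ u v' i) v) (fun i => deriv (fun v' => ψ u v' i) v)
          = 1 / 2) ∧
      (∀ i : Fin 5,
        iteratedDeriv 2 (fun u' => ψ u' v i) u + iteratedDeriv 2 (fun v' => ψ u v' i) v
          = ψ u v i) := by
  intro u v
  have hs : (1 / √2) ^ 2 = (1 / 2 : ℝ) := by simp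
  have hu : (fun i => deriv (fun u' => ψ u' v i) u) =
      ![(1 / √2) * sinh u, 0, 0, (1 / √2) * cosh u, 0] := by
    funext i
    fin_cases i <;> simp [hψ]
  have hv : (fun i => deriv (fun v' => ψ u v' i) v) =
      ![0, (1 / √2) * sinh v, 0, 0, (1 / √2) * cosh v] := by
    funext i
    fin_cases i <;> simp [hψ]
  rw [hu, hv, hψ]
  have hcu := cosh_sq u
  have hcv := cosh_sq v
  generalize 1 / √2 = c at *
  refine ⟨?_, ⟨?_, ?_, ?_⟩, fun i => ?_⟩
  · simp only [innerE53, Matrix.cons_val]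
    linear_combination -c ^ 2 * hcu - c ^ 2 * hcv - 2 * hs
  · simp only [innerE53, Matrix.cons_val]
    linear_combination c ^ 2 * hcu + hs
  · simp [innerE53]
  · simp only [innerE53, Matrix.cons_val]
    linear_combination c ^ 2 * hcv + hs
  · fin_cases i <;> simp [hψ, iteratedDeriv_succ]
end

section
/- Let m > 0 be a real number and define ψ : ℝ × ℝ → ℝ⁴ by ψ(x,y) = (1/(√2·m))·( cosh(√2·m·x), cosh(√2·m·y), sinh(√2·m·x), sinh(√2·m·y) ). Then for all (x,y) ∈ ℝ²: ⟨ψ(x,y), ψ(x,y)⟩ = -1/m², and ⟨∂ψ/∂x, ∂ψ/∂x⟩ = 1, ⟨∂ψ/∂x, ∂ψ/∂y⟩ = 0, ⟨∂ψ/∂y, ∂ψ/∂y⟩ = 1, where ⟨a,b⟩ = -a₁b₁ - a₂b₂ + a₃b₃ + a₄b₄. Hence ψ is a space-like isometric immersion of the flat Euclidean plane into E⁴₂. -/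
open Real

/-- The neutral pseudo-Euclidean inner product on `ℝ⁴ = Fin 4 → ℝ`,
`⟨a,b⟩ = -a₁b₁ - a₂b₂ + a₃b₃ + a₄b₄`. -/
def innerE42 (a b : Fin 4 → ℝ) : ℝ :=
  -(a 0 * b 0) - a 1 * b 1 + a 2 * b 2 + a 3 * b 3

theorem hasDerivAt_inv_mul_cosh_mul {c : ℝ} (hc : c ≠ 0) (t : ℝ) :
    HasDerivAt (fun s => 1 / c * Real.cosh (c * s)) (Real.sinh (c * t)) t := by
  refine ((((hasDerivAt_id' t).const_mul c).cosh).const_mul (1 / c)).congr_deriv ?_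
  field_simp

theorem hasDerivAt_inv_mul_sinh_mul {c : ℝ} (hc : c ≠ 0) (t : ℝ) :
    HasDerivAt (fun s => 1 / c * Real.sinh (c * s)) (Real.cosh (c * t)) t := by
  refine ((((hasDerivAt_id' t).const_mul c).sinh).const_mul (1 / c)).congr_deriv ?_
  field_simp

theorem flat_spacelike_surface_in_E42
    (m : ℝ) (hm : 0 < m) (ψ : ℝ → ℝ → Fin 4 → ℝ)
    (hψ : ∀ x y : ℝ, ψ x y =
      ![(1 / (Real.sqrt 2 * m)) * Real.cosh (Real.sqrt 2 * m * x),
        (1 / (Real.sqrt 2 * m)) * Real.cosh (Real.sqrt 2 * m * y),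
        (1 / (Real.sqrt 2 * m)) * Real.sinh (Real.sqrt 2 * m * x),
        (1 / (Real.sqrt 2 * m)) * Real.sinh (Real.sqrt 2 * m * y)]) :
    ∀ x y : ℝ,
      innerE42 (ψ x y) (ψ x y) = -1 / m ^ 2 ∧
      innerE42 (fun i => deriv (fun x' => ψ x' y i) x) (fun i => deriv (fun x' => ψ x' y i) x)
        = 1 ∧
      innerE42 (fun i => deriv (fun x' => ψ x' y i) x) (fun i => deriv (fun y' => ψ x y' i) y)
        = 0 ∧
      innerE42 (fun i => deriv (fun y' => ψ x y' i) y) (fun i => deriv (fun y' => ψ x y' i) y)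
        = 1 := by
  intro x y
  have hc : Real.sqrt 2 * m ≠ 0 := by positivity
  have hcosh (t : ℝ) := (hasDerivAt_inv_mul_cosh_mul hc t).deriv
  have hsinh (t : ℝ) := (hasDerivAt_inv_mul_sinh_mul hc t).deriv
  have hx := Real.cosh_sq (Real.sqrt 2 * m * x)
  have hy := Real.cosh_sq (Real.sqrt 2 * m * y)
  have hcsq : (1 / (Real.sqrt 2 * m)) ^ 2 = 1 / (2 * m ^ 2) := by
    rw [div_pow, mul_pow, Real.sq_sqrt zero_le_two, one_pow]
  have hnorm : -1 / m ^ 2 = -2 * (1 / (2 * m ^ 2)) := by field_simp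
  simp only [innerE42, hψ, Matrix.cons_val, hcosh, hsinh, deriv_const]
  refine ⟨?_, ?_, ?_, ?_⟩
  · rw [hnorm, ← hcsq]
    linear_combination -(1 / (Real.sqrt 2 * m)) ^ 2 * (hx + hy)
  · linear_combination hx
  · ring
  · linear_combination hy
end

section
/- Let b, m be real numbers with 0 < b < m, let Φ(τ) = (4·√(m² - b²)/b)·arctan(tanh(b·τ/2)), and define ψ : ℝ × ℝ → ℝ⁴ by ψ(x,y) = ( (1/b)·cosh(b·x)·cosh(b·y), ∫₀^y cosh(b·τ)·sinh(Φ(τ)) dτ, (1/b)·sinh(b·x)·cosh(b·y), ∫₀^y cosh(b·τ)·cosh(Φ(τ)) dτ ). Then for all (x,y) ∈ ℝ²: ⟨∂ψ/∂x, ∂ψ/∂x⟩ = cosh²(b·y), ⟨∂ψ/∂x, ∂ψ/∂y⟩ = 0, and ⟨∂ψ/∂y, ∂ψ/∂y⟩ = 1, where ⟨a,c⟩ = -a₁c₁ - a₂c₂ + a₃c₃ + a₄c₄. Hence ψ is a space-like immersion of E⁴₂ whose induced first fundamental form is cosh²(b·y) dx² + dy². -/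
open Real

theorem negative_curvature_spacelike_surface_in_E42
    (b m : ℝ) (hb : 0 < b) (hbm : b < m)
    (Φ : ℝ → ℝ)
    (hΦ : ∀ τ : ℝ, Φ τ =
      (4 * Real.sqrt (m ^ 2 - b ^ 2) / b) * Real.arctan (Real.tanh (b * τ / 2)))
    (ψ : ℝ → ℝ → Fin 4 → ℝ)
    (hψ : ∀ x y : ℝ, ψ x y =
      ![(1 / b) * Real.cosh (b * x) * Real.cosh (b * y),
        ∫ τ in (0 : ℝ)..y, Real.cosh (b * τ) * Real.sinh (Φ τ),
        (1 / b) * Real.sinh (b * x) * Real.cosh (b * y),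
        ∫ τ in (0 : ℝ)..y, Real.cosh (b * τ) * Real.cosh (Φ τ)]) :
    ∀ x y : ℝ,
      innerE42 (fun i => deriv (fun x' => ψ x' y i) x) (fun i => deriv (fun x' => ψ x' y i) x)
        = Real.cosh (b * y) ^ 2 ∧
      innerE42 (fun i => deriv (fun x' => ψ x' y i) x) (fun i => deriv (fun y' => ψ x y' i) y)
        = 0 ∧
      innerE42 (fun i => deriv (fun y' => ψ x y' i) y) (fun i => deriv (fun y' => ψ x y' i) y)
        = 1 := by
  have hΦc : Continuous Φ := by
    have hΦ' : Φ = fun τ => (4 * Real.sqrt (m ^ 2 - b ^ 2) / b) *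
        Real.arctan (Real.sinh (b * τ / 2) / Real.cosh (b * τ / 2)) := by
      funext τ
      rw [hΦ, Real.tanh_eq_sinh_div_cosh]
    rw [hΦ']
    refine continuous_const.mul (Real.continuous_arctan.comp ?_)
    exact Continuous.div (by fun_prop) (by fun_prop) fun τ => (Real.cosh_pos _).ne'
  have hcosh (t : ℝ) : HasDerivAt (fun t => Real.cosh (b * t)) (Real.sinh (b * t) * b) t := by
    simpa using ((hasDerivAt_id t).const_mul b).cosh
  have hsinh (t : ℝ) : HasDerivAt (fun t => Real.sinh (b * t)) (Real.cosh (b * t) * b) t := by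
    simpa using ((hasDerivAt_id t).const_mul b).sinh
  have hint {f : ℝ → ℝ} (hf : Continuous f) (y : ℝ) :
      deriv (fun y' => ∫ τ in (0 : ℝ)..y', f τ) y = f y := hf.deriv_integral f 0 y
  intro x y
  have hx0 : deriv (fun x' => ψ x' y 0) x = Real.sinh (b * x) * Real.cosh (b * y) := by
    simp only [hψ, Matrix.cons_val]
    rw [(((hcosh x).const_mul (1 / b)).mul_const (Real.cosh (b * y))).deriv]
    field_simp
  have hx1 : deriv (fun x' => ψ x' y 1) x = 0 := by
    simp [hψ]
  have hx2 : deriv (fun x' => ψ x' y 2) x = Real.cosh (b * x) * Real.cosh (b * y) := by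
    simp only [hψ, Matrix.cons_val]
    rw [(((hsinh x).const_mul (1 / b)).mul_const (Real.cosh (b * y))).deriv]
    field_simp
  have hx3 : deriv (fun x' => ψ x' y 3) x = 0 := by
    simp [hψ]
  have hy0 : deriv (fun y' => ψ x y' 0) y = Real.cosh (b * x) * Real.sinh (b * y) := by
    simp only [hψ, Matrix.cons_val]
    rw [((hcosh y).const_mul (1 / b * Real.cosh (b * x))).deriv]
    field_simp
  have hy1 : deriv (fun y' => ψ x y' 1) y = Real.cosh (b * y) * Real.sinh (Φ y) := by
    simp only [hψ, Matrix.cons_val]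
    exact hint (by fun_prop) y
  have hy2 : deriv (fun y' => ψ x y' 2) y = Real.sinh (b * x) * Real.sinh (b * y) := by
    simp only [hψ, Matrix.cons_val]
    rw [((hcosh y).const_mul (1 / b * Real.sinh (b * x))).deriv]
    field_simp
  have hy3 : deriv (fun y' => ψ x y' 3) y = Real.cosh (b * y) * Real.cosh (Φ y) := by
    simp only [hψ, Matrix.cons_val]
    exact hint (by fun_prop) y
  simp only [innerE42, hx0, hx1, hx2, hx3, hy0, hy1, hy2, hy3]
  have hcx := Real.cosh_sq (b * x)
  have hcy := Real.cosh_sq (b * y)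
  have hcΦ := Real.cosh_sq (Φ y)
  refine ⟨?_, ?_, ?_⟩
  · linear_combination Real.cosh (b * y) ^ 2 * hcx
  · ring
  · linear_combination -Real.sinh (b * y) ^ 2 * hcx + Real.cosh (b * y) ^ 2 * hcΦ + hcy
end

section
/- Let n and m be positive integers and let B₁, …, B_m be symmetric n×n real matrices. Then ( Σ_{r=1}^{m} ‖B_r‖² )² ≥ 2 · Σ_{1 ≤ r < s ≤ m} ‖B_r·B_s - B_s·B_r‖², where ‖C‖² = Σ_{i,j} C_{ij}² denotes the squared Frobenius norm. -/
open Matrix Finset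

section Spread

variable {ι : Type*} [Fintype ι]

theorem sum_sq_sub_sub_one_le_one {d : ι → ℝ} (hd : ∑ i, d i ^ 2 ≤ 1) {k : ι} {S : Finset ι}
    (hk : k ∉ S) : ∑ l ∈ S, ((d k - d l) ^ 2 - 1) ≤ 1 := by
  classical
  have h1 : d k ^ 2 + ∑ l ∈ S, d l ^ 2 ≤ 1 := by
    rw [← Finset.sum_insert (f := fun i => d i ^ 2) hk]
    exact (Finset.sum_le_univ_sum_of_nonneg fun i => sq_nonneg (d i)).trans hd
  have h2 : (∑ l ∈ S, d l) ^ 2 ≤ #S * ∑ l ∈ S, d l ^ 2 := sq_sum_le_card_mul_sum_sq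
  have h3 : ∑ l ∈ S, ((d k - d l) ^ 2 - 1) =
      #S * (d k ^ 2 - 1) - 2 * d k * ∑ l ∈ S, d l + ∑ l ∈ S, d l ^ 2 := by
    rw [Finset.mul_sum, ← nsmul_eq_mul, ← Finset.sum_const, ← Finset.sum_sub_distrib,
      ← Finset.sum_add_distrib]
    exact Finset.sum_congr rfl fun l _ => by ring
  have h4 : (0 : ℝ) ≤ #S := Nat.cast_nonneg _
  rw [h3]
  nlinarith [sq_nonneg (d k + ∑ l ∈ S, d l), mul_le_mul_of_nonneg_left h1 h4]

theorem fst_eq_or_snd_eq_of_one_lt_sub {d : ι → ℝ} (hd : ∑ i, d i ^ 2 ≤ 1) {k l k' l' : ι}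
    (h : 1 < d k - d l) (h' : 1 < d k' - d l') : k = k' ∨ l = l' := by
  classical
  have pair : ∀ i j, i ≠ j → d i ^ 2 + d j ^ 2 ≤ 1 := fun i j hij => by
    rw [← Finset.sum_pair (f := fun i => d i ^ 2) hij]
    exact (Finset.sum_le_univ_sum_of_nonneg fun i => sq_nonneg (d i)).trans hd
  have sign : ∀ i j, 1 < d i - d j → 0 < d i ∧ d j < 0 := fun i j hij => by
    have hne : i ≠ j := by rintro rfl; simp at hij; linarith
    have := pair i j hne
    constructor <;> nlinarith [sq_nonneg (d i), sq_nonneg (d j)]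
  obtain ⟨hk, hl⟩ := sign _ _ h
  obtain ⟨hk', hl'⟩ := sign _ _ h'
  by_contra! hne
  have h1 : k ≠ l := by rintro rfl; linarith
  have h2 : k ≠ l' := by rintro rfl; linarith
  have h3 : k' ≠ l := by rintro rfl; linarith
  have h4 : k' ≠ l' := by rintro rfl; linarith
  have key : d k ^ 2 + (d k' ^ 2 + (d l ^ 2 + d l' ^ 2)) ≤ 1 := by
    have : ∑ i ∈ {k, k', l, l'}, d i ^ 2 ≤ 1 :=
      (Finset.sum_le_univ_sum_of_nonneg fun i => sq_nonneg (d i)).trans hd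
    rwa [Finset.sum_insert (by simp [hne.1, h1, h2]), Finset.sum_insert (by simp [h3, h4]),
      Finset.sum_pair hne.2] at this
  nlinarith [sq_nonneg (d k + d l), sq_nonneg (d k' + d l')]

theorem sum_excess_le_one {d : ι → ℝ} (hd : ∑ i, d i ^ 2 ≤ 1) :
    ∑ k, ∑ l, (if 1 < d k - d l then (d k - d l) ^ 2 - 1 else 0) ≤ 1 := by
  classical
  by_cases hrow : ∃ k₀, ∀ k l, 1 < d k - d l → k = k₀
  · obtain ⟨k₀, hk₀⟩ := hrow
    rw [Finset.sum_eq_single k₀ (fun k _ hk => Finset.sum_eq_zero fun l _ =>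
      if_neg fun h => hk (hk₀ k l h)) (by simp), ← Finset.sum_filter]
    exact sum_sq_sub_sub_one_le_one hd (by simp)
  · by_cases hcol : ∃ l₀, ∀ k l, 1 < d k - d l → l = l₀
    · obtain ⟨l₀, hl₀⟩ := hcol
      rw [Finset.sum_comm, Finset.sum_eq_single l₀ (fun l _ hl => Finset.sum_eq_zero fun k _ =>
        if_neg fun h => hl (hl₀ k l h)) (by simp), ← Finset.sum_filter]
      simp_rw [sub_sq_comm (d _) (d l₀)]
      exact sum_sq_sub_sub_one_le_one hd (by simp)
    · rw [Finset.sum_eq_zero fun k _ => Finset.sum_eq_zero fun l _ => if_neg fun h => ?_]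
      · exact zero_le_one
      · push Not at hrow hcol
        obtain ⟨k₁, l₁, h₁, hk₁⟩ := hrow k
        obtain ⟨k₂, l₂, h₂, hl₂⟩ := hcol l
        have e₁ := (fst_eq_or_snd_eq_of_one_lt_sub hd h₁ h).resolve_left hk₁
        have e₂ := (fst_eq_or_snd_eq_of_one_lt_sub hd h₂ h).resolve_right hl₂
        rcases fst_eq_or_snd_eq_of_one_lt_sub hd h₁ h₂ with e | e
        · exact hk₁ (e.trans e₂)
        · exact hl₂ (e.symm.trans e₁)

end Spread

section Frobenius

variable {n ι : Type*} [Fintype n]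

/-- The Frobenius inner product of two real matrices. -/
def frobInner (A B : Matrix n n ℝ) : ℝ := (Aᵀ * B).trace

theorem frobInner_eq_sum (A B : Matrix n n ℝ) : frobInner A B = ∑ i, ∑ j, A i j * B i j := by
  rw [Finset.sum_comm]
  simp [frobInner, trace, mul_apply]

theorem frobInner_self (A : Matrix n n ℝ) : frobInner A A = ∑ i, ∑ j, A i j ^ 2 := by
  simp [frobInner_eq_sum, sq]

theorem frobInner_self_nonneg (A : Matrix n n ℝ) : 0 ≤ frobInner A A := by
  rw [frobInner_self]; positivity

theorem frobInner_comm (A B : Matrix n n ℝ) : frobInner A B = frobInner B A := by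
  simp [frobInner_eq_sum, mul_comm]

theorem frobInner_sum_left (s : Finset ι) (F : ι → Matrix n n ℝ) (B : Matrix n n ℝ) :
    frobInner (∑ i ∈ s, F i) B = ∑ i ∈ s, frobInner (F i) B := by
  simp [frobInner, transpose_sum, Finset.sum_mul, trace_sum]

theorem frobInner_sum_right (s : Finset ι) (F : ι → Matrix n n ℝ) (B : Matrix n n ℝ) :
    frobInner B (∑ i ∈ s, F i) = ∑ i ∈ s, frobInner B (F i) := by
  simp [frobInner, Finset.mul_sum, trace_sum]

theorem frobInner_smul_left (c : ℝ) (A B : Matrix n n ℝ) :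
    frobInner (c • A) B = c * frobInner A B := by
  simp [frobInner]

theorem frobInner_smul_right (c : ℝ) (A B : Matrix n n ℝ) :
    frobInner A (c • B) = c * frobInner A B := by
  simp [frobInner]

theorem frobInner_conj [DecidableEq n] {V : Matrix n n ℝ} (hV : V * Vᵀ = 1)
    (A B : Matrix n n ℝ) : frobInner (Vᵀ * A * V) (Vᵀ * B * V) = frobInner A B := by
  have h : (Vᵀ * A * V)ᵀ * (Vᵀ * B * V) = Vᵀ * (Aᵀ * B * V) := by
    have : (Vᵀ * A * V)ᵀ * (Vᵀ * B * V) = Vᵀ * (Aᵀ * (V * Vᵀ) * B * V) := by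
      simp [Matrix.mul_assoc]
    rw [this, hV, Matrix.mul_one]
  rw [frobInner, frobInner, h, trace_mul_comm, Matrix.mul_assoc, hV, Matrix.mul_one]

theorem bessel_frobInner {s : Finset ι} {E : ι → Matrix n n ℝ}
    (horth : ∀ i j, i ≠ j → frobInner (E i) (E j) = 0) (hE : ∀ i, frobInner (E i) (E i) ≤ 1)
    (P : Matrix n n ℝ) : ∑ j ∈ s, frobInner (E j) P ^ 2 ≤ frobInner P P := by
  classical
  have h := frobInner_self_nonneg (P - ∑ j ∈ s, frobInner (E j) P • E j)
  have hexp : ∀ A B : Matrix n n ℝ, frobInner (A - B) (A - B) =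
      frobInner A A - 2 * frobInner B A + frobInner B B := fun A B => by
    have := frobInner_comm A B
    simp only [frobInner, transpose_sub, sub_mul, mul_sub, trace_sub] at this ⊢
    linarith
  rw [hexp, frobInner_sum_left, frobInner_sum_left] at h
  have h1 : ∑ j ∈ s, frobInner (frobInner (E j) P • E j) P = ∑ j ∈ s, frobInner (E j) P ^ 2 :=
    Finset.sum_congr rfl fun j _ => by rw [frobInner_smul_left, sq]
  have h2 : ∑ i ∈ s, frobInner (frobInner (E i) P • E i) (∑ j ∈ s, frobInner (E j) P • E j) ≤
      ∑ j ∈ s, frobInner (E j) P ^ 2 := by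
    refine Finset.sum_le_sum fun i hi => ?_
    rw [frobInner_sum_right, Finset.sum_eq_single i (fun j _ hj => by
      rw [frobInner_smul_left, frobInner_smul_right, horth i j hj.symm, mul_zero, mul_zero])
      (fun h => absurd hi h), frobInner_smul_left, frobInner_smul_right]
    nlinarith [hE i, sq_nonneg (frobInner (E i) P)]
  linarith

theorem exists_orthogonal_diagonalization [DecidableEq n] {A : Matrix n n ℝ} (hA : A.IsSymm) :
    ∃ (V : Matrix n n ℝ) (d : n → ℝ), V * Vᵀ = 1 ∧ Vᵀ * A * V = diagonal d := by
  have hH : A.IsHermitian := by rw [IsHermitian, conjTranspose_eq_transpose_of_trivial, hA]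
  have h1 := hH.conjStarAlgAut_star_eigenvectorUnitary
  rw [Unitary.conjStarAlgAut_star_apply] at h1
  have h2 := Unitary.coe_mul_star_self hH.eigenvectorUnitary
  simp only [star_eq_conjTranspose, conjTranspose_eq_transpose_of_trivial] at h1 h2
  exact ⟨hH.eigenvectorUnitary, _, h2, h1⟩

theorem sum_mul_sq_apply_le [DecidableEq n] {s : Finset ι} {E : ι → Matrix n n ℝ}
    (hsymm : ∀ i, (E i).IsSymm)
    (horth : ∀ i j, i ≠ j → frobInner (E i) (E j) = 0) (hE : ∀ i, frobInner (E i) (E i) ≤ 1)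
    {x : ι → ℝ} {b : ℝ} (hb : 0 ≤ b) (hxb : ∀ i, x i ≤ b) {k l : n} (hkl : k ≠ l) :
    2 * ∑ j ∈ s, x j * E j k l ^ 2 ≤ b := by
  have h := bessel_frobInner (s := s) horth hE (single k l 1 + single l k 1)
  have hP : ∀ A : Matrix n n ℝ,
      frobInner A (single k l 1 + single l k 1) = A k l + A l k := fun A => by
    simp [frobInner, mul_add, trace_add, trace_mul_single]
  have hself : ∀ j, E j l k = E j k l := fun j => (hsymm j).apply k l
  simp only [hP, hself] at h
  simp only [Matrix.add_apply, single_apply, hkl, hkl.symm, and_self, if_true, if_false] at h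
  have h2 : ∑ j ∈ s, x j * E j k l ^ 2 ≤ b * ∑ j ∈ s, E j k l ^ 2 := by
    rw [Finset.mul_sum]
    exact Finset.sum_le_sum fun j _ => mul_le_mul_of_nonneg_right (hxb j) (sq_nonneg _)
  have h3 : ∑ j ∈ s, (E j k l + E j k l) ^ 2 = 4 * ∑ j ∈ s, E j k l ^ 2 := by
    rw [Finset.mul_sum]
    exact Finset.sum_congr rfl fun j _ => by ring
  rw [h3] at h
  nlinarith

theorem sum_mul_frobInner_commutator_diagonal_le [DecidableEq n] {s : Finset ι}
    {E : ι → Matrix n n ℝ} (hsymm : ∀ i, (E i).IsSymm)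
    (horth : ∀ i j, i ≠ j → frobInner (E i) (E j) = 0) (hE : ∀ i, frobInner (E i) (E i) ≤ 1)
    {x : ι → ℝ} {b : ℝ} (hb : 0 ≤ b) (hx : ∀ i, 0 ≤ x i) (hxb : ∀ i, x i ≤ b)
    {d : n → ℝ} (hd : ∑ i, d i ^ 2 ≤ 1) :
    ∑ j ∈ s, x j * frobInner (diagonal d * E j - E j * diagonal d)
      (diagonal d * E j - E j * diagonal d) ≤ ∑ j ∈ s, x j + b := by
  set h : n → n → ℝ := fun k l => if 1 < d k - d l then (d k - d l) ^ 2 - 1 else 0 with h_def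
  have h_nonneg : ∀ k l, 0 ≤ h k l := fun k l => by
    simp only [h_def]; split_ifs <;> nlinarith
  have h_diag : ∀ k, h k k = 0 := fun k => by
    simp only [h_def]; rw [if_neg (by simp)]
  have h_sq : ∀ k l, (d k - d l) ^ 2 ≤ 1 + (h k l + h l k) := fun k l => by
    simp only [h_def]; split_ifs <;> nlinarith
  have hterm : ∀ j, x j * frobInner (diagonal d * E j - E j * diagonal d)
      (diagonal d * E j - E j * diagonal d) ≤
      x j + ∑ k, ∑ l, (h k l + h l k) * (x j * E j k l ^ 2) := fun j => by
    have : frobInner (diagonal d * E j - E j * diagonal d)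
        (diagonal d * E j - E j * diagonal d) ≤
        frobInner (E j) (E j) + ∑ k, ∑ l, (h k l + h l k) * E j k l ^ 2 := by
      rw [frobInner_self, frobInner_self, ← Finset.sum_add_distrib]
      simp_rw [← Finset.sum_add_distrib]
      refine Finset.sum_le_sum fun k _ => Finset.sum_le_sum fun l _ => ?_
      rw [Matrix.sub_apply, diagonal_mul, mul_diagonal]
      nlinarith [mul_le_mul_of_nonneg_right (h_sq k l) (sq_nonneg (E j k l))]
    calc _ ≤ x j * (1 + ∑ k, ∑ l, (h k l + h l k) * E j k l ^ 2) :=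
          mul_le_mul_of_nonneg_left (this.trans (by linarith [hE j])) (hx j)
      _ = _ := by
          rw [mul_add, mul_one, Finset.mul_sum]
          simp_rw [Finset.mul_sum]
          congr 1
          exact Finset.sum_congr rfl fun k _ => Finset.sum_congr rfl fun l _ => by ring
  have hswap : ∑ j ∈ s, ∑ k, ∑ l, (h k l + h l k) * (x j * E j k l ^ 2) =
      ∑ k, ∑ l, (h k l + h l k) * ∑ j ∈ s, x j * E j k l ^ 2 := by
    rw [Finset.sum_comm]
    refine Finset.sum_congr rfl fun k _ => ?_
    rw [Finset.sum_comm]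
    exact Finset.sum_congr rfl fun l _ => by rw [Finset.mul_sum]
  have hentry : ∀ k l, (h k l + h l k) * ∑ j ∈ s, x j * E j k l ^ 2 ≤
      (h k l + h l k) * (b / 2) := fun k l => by
    rcases eq_or_ne k l with rfl | hkl
    · simp [h_diag]
    · refine mul_le_mul_of_nonneg_left ?_ (add_nonneg (h_nonneg _ _) (h_nonneg _ _))
      linarith [sum_mul_sq_apply_le (s := s) hsymm horth hE hb hxb hkl]
  have hsum : ∑ k, ∑ l, h k l ≤ 1 := sum_excess_le_one hd
  calc _ ≤ ∑ j ∈ s, (x j + ∑ k, ∑ l, (h k l + h l k) * (x j * E j k l ^ 2)) :=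
        Finset.sum_le_sum fun j _ => hterm j
    _ ≤ ∑ j ∈ s, x j + ∑ k, ∑ l, (h k l + h l k) * (b / 2) := by
        rw [Finset.sum_add_distrib, hswap]
        exact add_le_add le_rfl
          (Finset.sum_le_sum fun k _ => Finset.sum_le_sum fun l _ => hentry k l)
    _ = ∑ j ∈ s, x j + (∑ k, ∑ l, h k l) * b := by
        simp_rw [← Finset.sum_mul, Finset.sum_add_distrib]
        rw [Finset.sum_comm (f := fun k l => h l k)]
        ring
    _ ≤ _ := by nlinarith

theorem sum_mul_frobInner_commutator_le {s : Finset ι}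
    {E : ι → Matrix n n ℝ} (hsymm : ∀ i, (E i).IsSymm)
    (horth : ∀ i j, i ≠ j → frobInner (E i) (E j) = 0) (hE : ∀ i, frobInner (E i) (E i) ≤ 1)
    {x : ι → ℝ} {b : ℝ} (hb : 0 ≤ b) (hx : ∀ i, 0 ≤ x i) (hxb : ∀ i, x i ≤ b)
    {A : Matrix n n ℝ} (hA : A.IsSymm) (hA1 : frobInner A A ≤ 1) :
    ∑ j ∈ s, x j * frobInner (A * E j - E j * A) (A * E j - E j * A) ≤ ∑ j ∈ s, x j + b := by
  classical
  obtain ⟨V, d, hV, hd⟩ := exists_orthogonal_diagonalization hA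
  have hmul : ∀ X Y : Matrix n n ℝ, Vᵀ * (X * Y) * V = (Vᵀ * X * V) * (Vᵀ * Y * V) :=
    fun X Y => by
      have : (Vᵀ * X * V) * (Vᵀ * Y * V) = Vᵀ * X * (V * Vᵀ) * Y * V := by
        simp [Matrix.mul_assoc]
      rw [this, hV]; simp [Matrix.mul_assoc]
  have hd1 : ∑ i, d i ^ 2 ≤ 1 := by
    rw [← frobInner_conj hV, hd] at hA1
    simpa [frobInner, trace, sq] using hA1
  have h := sum_mul_frobInner_commutator_diagonal_le (s := s) (E := fun j => Vᵀ * E j * V)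
    (fun j => by simp [IsSymm, (hsymm j).eq, Matrix.mul_assoc])
    (fun i j hij => by rw [frobInner_conj hV, horth i j hij])
    (fun i => by rw [frobInner_conj hV]; exact hE i) hb hx hxb hd1
  simpa only [← hd, ← hmul, ← Matrix.sub_mul, ← Matrix.mul_sub, frobInner_conj hV] using h

end Frobenius

theorem sum_mul_mul_le_sq_sum {ι : Type*} [Fintype ι] {c : ι → ι → ℝ}
    (hsymm : ∀ i j, c i j = c j i) (hdiag : ∀ i, 0 ≤ c i i)
    (hc : ∀ (x : ι → ℝ) (i : ι), (∀ j, 0 ≤ x j) → (∀ j, x j ≤ x i) →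
      ∑ j, x j * c i j ≤ ∑ j, x j) {x : ι → ℝ} (hx : ∀ i, 0 ≤ x i) :
    ∑ i, ∑ j, x i * x j * c i j ≤ (∑ i, x i) ^ 2 := by
  classical
  set Q : (ι → ℝ) → ℝ := fun y => ∑ i, ∑ j, y i * y j * c i j with hQ
  have hQ_smul : ∀ (t : ℝ) (y : ι → ℝ), Q (t • y) = t ^ 2 * Q y := fun t y => by
    simp only [hQ, Finset.mul_sum, Pi.smul_apply, smul_eq_mul]
    exact Finset.sum_congr rfl fun i _ => Finset.sum_congr rfl fun j _ => by ring
  have hS : 0 ≤ ∑ i, x i := Finset.sum_nonneg fun i _ => hx i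
  rcases hS.eq_or_lt with h0 | hpos
  · have hx0 : ∀ i, x i = 0 := fun i =>
      (Finset.sum_eq_zero_iff_of_nonneg fun i _ => hx i).1 h0.symm i (Finset.mem_univ i)
    simp [hx0]
  have hmem : (∑ i, x i)⁻¹ • x ∈ stdSimplex ℝ ι :=
    ⟨fun i => mul_nonneg (inv_nonneg.2 hS) (hx i), by
      simp [← Finset.mul_sum, hpos.ne']⟩
  have hcont : Continuous Q := by simp only [hQ]; fun_prop
  obtain ⟨p, hp, hmax⟩ := (isCompact_stdSimplex ℝ ι).exists_isMaxOn ⟨_, hmem⟩ hcont.continuousOn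
  have hgrad : ∀ i, ∑ j, p j * c i j ≤ Q p := fun i => by
    have hstep : ∀ t : ℝ, 0 ≤ t → t ≤ 1 →
        (1 - t) ^ 2 * Q p + 2 * t * (1 - t) * ∑ j, p j * c i j + t ^ 2 * c i i ≤ Q p := by
      intro t ht0 ht1
      have hin : (1 - t) • p + t • Pi.single i 1 ∈ stdSimplex ℝ ι :=
        convex_stdSimplex ℝ ι hp (single_mem_stdSimplex ℝ i) (by linarith) ht0 (by ring)
      have hle : Q ((1 - t) • p + t • Pi.single i 1) ≤ Q p := hmax hin
      refine le_of_eq_of_le ?_ hle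
      have hentry : ∀ k l, ((1 - t) • p + t • Pi.single i 1 : ι → ℝ) k *
          ((1 - t) • p + t • Pi.single i 1 : ι → ℝ) l * c k l =
          (1 - t) ^ 2 * (p k * p l * c k l) +
          t * (1 - t) * ((if k = i then p l * c k l else 0) + (if l = i then p k * c k l else 0)) +
          t ^ 2 * (if k = i then (if l = i then c k l else 0) else 0) := fun k l => by
        simp only [Pi.add_apply, Pi.smul_apply, Pi.single_apply, smul_eq_mul]
        split_ifs <;> ring
      simp only [hQ, hentry, Finset.sum_add_distrib, ← Finset.mul_sum, Finset.sum_ite_eq',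
        Finset.mem_univ, if_true, Finset.sum_ite_irrel, Finset.sum_const_zero, hsymm _ i]
      ring
    by_contra! hlt
    set g := ∑ j, p j * c i j
    obtain ⟨t, ht0, ht1, ht⟩ : ∃ t : ℝ, 0 < t ∧ t ≤ 1 ∧ t * (2 * g - Q p) < 2 * (g - Q p) := by
      have hδ : 0 < g - Q p := by linarith
      refine ⟨(g - Q p) / (g - Q p + |2 * g - Q p|), by positivity, ?_, ?_⟩
      · rw [div_le_one (by positivity)]
        linarith [abs_nonneg (2 * g - Q p)]
      · have hle : (g - Q p) / (g - Q p + |2 * g - Q p|) * (2 * g - Q p) ≤ g - Q p := by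
          rw [div_mul_eq_mul_div, div_le_iff₀ (by positivity)]
          nlinarith [le_abs_self (2 * g - Q p)]
        linarith
    have := hstep t ht0.le ht1
    nlinarith [mul_nonneg (sq_nonneg t) (hdiag i)]
  have hQp : ∑ i, p i * ∑ j, p j * c i j = Q p := by
    simp only [hQ, Finset.mul_sum, mul_assoc]
  obtain ⟨i₁, hi₁⟩ : ∃ i, 0 < p i := by
    by_contra! hle
    have := Finset.sum_nonpos fun i (_ : i ∈ Finset.univ) => hle i
    linarith [hp.2]
  obtain ⟨i, -, hi⟩ := Finset.exists_max_image Finset.univ p ⟨i₁, Finset.mem_univ _⟩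
  have hpi : 0 < p i := hi₁.trans_le (hi i₁ (Finset.mem_univ _))
  have heq : Q p ≤ ∑ j, p j * c i j := by
    have hzero : ∑ k, p k * (Q p - ∑ j, p j * c k j) = 0 := by
      simp only [mul_sub, Finset.sum_sub_distrib, hQp, ← Finset.sum_mul, hp.2]
      ring
    have hi0 := (Finset.sum_eq_zero_iff_of_nonneg fun k _ =>
      mul_nonneg (hp.1 k) (sub_nonneg.2 (hgrad k))).1 hzero i (Finset.mem_univ i)
    have := (mul_eq_zero.1 hi0).resolve_left hpi.ne'
    linarith
  have hQ1 : Q p ≤ 1 :=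
    heq.trans ((hc p i hp.1 fun j => hi j (Finset.mem_univ j)).trans hp.2.le)
  have hfin : Q ((∑ i, x i)⁻¹ • x) ≤ 1 := (hmax hmem).trans hQ1
  rw [hQ_smul, inv_pow, inv_mul_le_iff₀ (by positivity), mul_one] at hfin
  exact hfin

section Families

variable {n ι : Type*} [Fintype n] [Fintype ι]

theorem sum_frobInner_commutator_le_of_orthogonal {B : ι → Matrix n n ℝ}
    (hB : ∀ r, (B r).IsSymm) (horth : ∀ r s, r ≠ s → frobInner (B r) (B s) = 0) :
    ∑ r, ∑ s, frobInner (B r * B s - B s * B r) (B r * B s - B s * B r) ≤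
      (∑ r, frobInner (B r) (B r)) ^ 2 := by
  classical
  set x : ι → ℝ := fun r => frobInner (B r) (B r) with hx_def
  have hx : ∀ r, 0 ≤ x r := fun r => frobInner_self_nonneg _
  set E : ι → Matrix n n ℝ := fun r => (√(x r))⁻¹ • B r with hE_def
  have hBE : ∀ r, B r = √(x r) • E r := fun r => by
    rcases (hx r).eq_or_lt with h0 | hpos
    · have : B r = 0 := by
        have h1 : frobInner (B r) (B r) = 0 := h0.symm
        rwa [frobInner, ← conjTranspose_eq_transpose_of_trivial,
          trace_conjTranspose_mul_self_eq_zero_iff] at h1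
      simp [hE_def, this]
    · rw [hE_def, smul_smul, mul_inv_cancel₀ (Real.sqrt_pos.2 hpos).ne', one_smul]
  have hEsymm : ∀ r, (E r).IsSymm := fun r => (hB r).smul _
  have hEorth : ∀ r s, r ≠ s → frobInner (E r) (E s) = 0 := fun r s hrs => by
    simp only [hE_def, frobInner_smul_left, frobInner_smul_right, horth r s hrs, mul_zero]
  have hE1 : ∀ r, frobInner (E r) (E r) ≤ 1 := fun r => by
    simp only [hE_def, frobInner_smul_left, frobInner_smul_right]
    rw [← mul_assoc, ← mul_inv, Real.mul_self_sqrt (hx r)]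
    exact inv_mul_le_one
  have hcomm : ∀ r s, frobInner (B r * B s - B s * B r) (B r * B s - B s * B r) =
      x r * x s * frobInner (E r * E s - E s * E r) (E r * E s - E s * E r) := fun r s => by
    have h : B r * B s - B s * B r = (√(x r) * √(x s)) • (E r * E s - E s * E r) := by
      rw [hBE r, hBE s]
      simp only [smul_mul_assoc, mul_smul_comm, smul_smul, smul_sub, mul_comm]
    rw [h, frobInner_smul_left, frobInner_smul_right, ← mul_assoc, mul_mul_mul_comm,
      Real.mul_self_sqrt (hx r), Real.mul_self_sqrt (hx s)]
  simp only [hcomm]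
  refine sum_mul_mul_le_sq_sum (c := fun r s => frobInner (E r * E s - E s * E r)
    (E r * E s - E s * E r)) (fun r s => ?_) (fun r => frobInner_self_nonneg _) ?_ hx
  · rw [frobInner_self, frobInner_self]
    simp only [Matrix.sub_apply]
    exact Finset.sum_congr rfl fun i _ => Finset.sum_congr rfl fun j _ => sub_sq_comm _ _
  · intro y i hy hyi
    have h := sum_mul_frobInner_commutator_le (s := Finset.univ.erase i) hEsymm hEorth hE1
      (hy i) hy hyi (hEsymm i) (hE1 i)
    rw [Finset.sum_erase_add _ _ (Finset.mem_univ i)] at h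
    rwa [Finset.sum_erase _ (by simp [frobInner])] at h

theorem sum_frobInner_rotate [DecidableEq ι] {U : Matrix ι ι ℝ} (hU : U * Uᵀ = 1)
    (F : ι → Matrix n n ℝ) :
    ∑ s, frobInner (∑ r, U r s • F r) (∑ r, U r s • F r) = ∑ r, frobInner (F r) (F r) := by
  have h : ∀ r t, ∑ s, U r s * U t s = if r = t then 1 else 0 := fun r t => by
    have := congrFun (congrFun hU r) t
    simpa [mul_apply, one_apply] using this
  calc _ = ∑ s, ∑ r, ∑ t, U r s * U t s * frobInner (F r) (F t) := by
        simp only [frobInner_sum_left, frobInner_smul_left]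
        simp only [frobInner_sum_right, frobInner_smul_right, Finset.mul_sum, mul_assoc]
    _ = ∑ r, ∑ t, (∑ s, U r s * U t s) * frobInner (F r) (F t) := by
        rw [Finset.sum_comm]
        refine Finset.sum_congr rfl fun r _ => ?_
        rw [Finset.sum_comm]
        exact Finset.sum_congr rfl fun t _ => by rw [Finset.sum_mul]
    _ = _ := by simp [h]

theorem sum_frobInner_commutator_le {B : ι → Matrix n n ℝ} (hB : ∀ r, (B r).IsSymm) :
    ∑ r, ∑ s, frobInner (B r * B s - B s * B r) (B r * B s - B s * B r) ≤
      (∑ r, frobInner (B r) (B r)) ^ 2 := by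
  classical
  have hG : (Matrix.of fun r s => frobInner (B r) (B s)).IsSymm :=
    IsSymm.ext fun r s => frobInner_comm _ _
  obtain ⟨U, d, hU, hd⟩ := exists_orthogonal_diagonalization hG
  set C : ι → Matrix n n ℝ := fun s => ∑ r, U r s • B r with hC_def
  have hC : ∀ s, (C s).IsSymm := fun s => by
    simp only [hC_def, IsSymm, transpose_sum, transpose_smul, (hB _).eq]
  have horth : ∀ s t, s ≠ t → frobInner (C s) (C t) = 0 := fun s t hst => by
    have h := congrFun (congrFun hd s) t
    rw [diagonal_apply_ne _ hst] at h
    rw [← h]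
    simp only [hC_def, frobInner_sum_left, frobInner_sum_right, frobInner_smul_left,
      frobInner_smul_right, mul_apply, transpose_apply, of_apply, Finset.sum_mul, Finset.mul_sum]
    exact Finset.sum_congr rfl fun r _ => Finset.sum_congr rfl fun k _ => by ring
  have hleft : ∀ s (X : Matrix n n ℝ),
      C s * X - X * C s = ∑ r, U r s • (B r * X - X * B r) := fun s X => by
    simp only [hC_def, Finset.sum_mul, Finset.mul_sum, smul_mul_assoc, mul_smul_comm, smul_sub,
      Finset.sum_sub_distrib]
  have hright : ∀ t (X : Matrix n n ℝ),
      X * C t - C t * X = ∑ r, U r t • (X * B r - B r * X) := fun s X => by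
    simp only [hC_def, Finset.sum_mul, Finset.mul_sum, smul_mul_assoc, mul_smul_comm, smul_sub,
      Finset.sum_sub_distrib]
  have h := sum_frobInner_commutator_le_of_orthogonal hC horth
  have hcomm : ∑ s, ∑ t, frobInner (C s * C t - C t * C s) (C s * C t - C t * C s) =
      ∑ r, ∑ s, frobInner (B r * B s - B s * B r) (B r * B s - B s * B r) := by
    simp only [hright, sum_frobInner_rotate hU]
    rw [Finset.sum_comm]
    simp only [hleft, sum_frobInner_rotate hU]
    rw [Finset.sum_comm]
  rwa [hcomm, sum_frobInner_rotate hU] at h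

end Families

theorem ddvv_matrix_inequality
    (n m : ℕ) (hn : 0 < n) (hm : 0 < m)
    (B : Fin m → Matrix (Fin n) (Fin n) ℝ) (hB : ∀ r, (B r).IsSymm) :
    (∑ r, ∑ i, ∑ j, (B r i j) ^ 2) ^ 2 ≥
      2 * ∑ r, ∑ s, if r < s then
        ∑ i, ∑ j, ((B r * B s - B s * B r) i j) ^ 2 else 0 := by
  have h := sum_frobInner_commutator_le hB
  simp only [frobInner_self] at h
  refine le_trans (le_of_eq ?_) h
  set f : Fin m → Fin m → ℝ := fun r s => ∑ i, ∑ j, ((B r * B s - B s * B r) i j) ^ 2 with hf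
  have hsymm : ∀ r s, f s r = f r s := fun r s => by
    simp only [hf, Matrix.sub_apply]
    exact Finset.sum_congr rfl fun i _ => Finset.sum_congr rfl fun j _ => sub_sq_comm _ _
  have hsplit : ∀ r s, f r s = (if r < s then f r s else 0) + (if s < r then f s r else 0) :=
    fun r s => by
      rcases lt_trichotomy r s with hrs | rfl | hrs
      · simp [hrs, hrs.not_gt]
      · simp [hf]
      · simp [hrs, hrs.not_gt, hsymm]
  calc _ = ∑ r, ∑ s, (if r < s then f r s else 0) + ∑ r, ∑ s, (if s < r then f s r else 0) := by
        rw [Finset.sum_comm (f := fun r s => if s < r then f s r else 0), two_mul]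
    _ = _ := by
        simp only [← Finset.sum_add_distrib, ← hsplit]
        rfl
end

section
/- Let n be a positive integer and let A and B be symmetric n×n real matrices. Then ( ‖A‖² + ‖B‖² )² ≥ 2 · ‖A·B - B·A‖², where ‖C‖² = Σ_{i,j} C_{ij}² denotes the squared Frobenius norm. -/
open Matrix Finset

theorem sum_sq_entries_eq_trace {ι : Type*} [Fintype ι] (M : Matrix ι ι ℝ) :
    ∑ i, ∑ j, M i j ^ 2 = (M * Mᵀ).trace := by
  simp [Matrix.trace, Matrix.mul_apply, sq]

theorem sum_sq_entries_orthogonal_conj {ι : Type*} [Fintype ι] [DecidableEq ι]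
    {U : Matrix ι ι ℝ} (hU : U * Uᵀ = 1) (M : Matrix ι ι ℝ) :
    ∑ i, ∑ j, (Uᵀ * M * U) i j ^ 2 = ∑ i, ∑ j, M i j ^ 2 := by
  have h : Uᵀ * M * U * (Uᵀ * M * U)ᵀ = Uᵀ * (M * Mᵀ * U) := by
    calc Uᵀ * M * U * (Uᵀ * M * U)ᵀ = Uᵀ * M * (U * Uᵀ) * Mᵀ * U := by
          simp only [Matrix.transpose_mul, Matrix.transpose_transpose, Matrix.mul_assoc]
      _ = Uᵀ * (M * Mᵀ * U) := by simp only [hU, Matrix.mul_one, Matrix.mul_assoc]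
  rw [sum_sq_entries_eq_trace, sum_sq_entries_eq_trace, h, Matrix.trace_mul_comm,
    Matrix.mul_assoc, hU, Matrix.mul_one]

theorem sum_sq_commutator_diagonal_le {ι : Type*} [Fintype ι] [DecidableEq ι]
    (d : ι → ℝ) (B : Matrix ι ι ℝ) :
    ∑ i, ∑ j, (diagonal d * B - B * diagonal d) i j ^ 2 ≤
      2 * (∑ i, d i ^ 2) * ∑ i, ∑ j, B i j ^ 2 := by
  simp only [Finset.mul_sum]
  refine Finset.sum_le_sum fun i _ => Finset.sum_le_sum fun j _ => ?_
  have h : (diagonal d * B - B * diagonal d) i j ^ 2 = (d i - d j) ^ 2 * B i j ^ 2 := by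
    rw [Matrix.sub_apply, Matrix.diagonal_mul, Matrix.mul_diagonal]
    ring
  rw [h, ← Finset.mul_sum]
  refine mul_le_mul_of_nonneg_right ?_ (sq_nonneg _)
  rcases eq_or_ne i j with rfl | hij
  · rw [sub_self, zero_pow two_ne_zero]
    positivity
  · have hpair : d i ^ 2 + d j ^ 2 ≤ ∑ k, d k ^ 2 := by
      rw [← Finset.sum_pair (f := fun k => d k ^ 2) hij]
      exact Finset.sum_le_univ_sum_of_nonneg fun k => sq_nonneg (d k)
    linarith [sq_nonneg (d i + d j)]

theorem exists_orthogonal_conj_eq_diagonal {ι : Type*} [Fintype ι] [DecidableEq ι]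
    {A : Matrix ι ι ℝ} (hA : A.IsSymm) :
    ∃ (U : Matrix ι ι ℝ) (d : ι → ℝ), U * Uᵀ = 1 ∧ Uᵀ * A * U = diagonal d := by
  have hH : A.IsHermitian := by
    rw [Matrix.IsHermitian, Matrix.conjTranspose_eq_transpose_of_trivial, hA.eq]
  refine ⟨hH.eigenvectorUnitary, hH.eigenvalues, ?_, ?_⟩
  · simpa [Matrix.star_eq_conjTranspose] using Unitary.coe_mul_star_self hH.eigenvectorUnitary
  · simpa [Matrix.star_eq_conjTranspose, Unitary.conjStarAlgAut_apply] using
      hH.conjStarAlgAut_star_eigenvectorUnitary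

/-- The Böttcher–Wenzel bound when one of the two matrices is symmetric. -/
theorem sum_sq_commutator_le_of_isSymm {ι : Type*} [Fintype ι] [DecidableEq ι]
    {A : Matrix ι ι ℝ} (hA : A.IsSymm) (B : Matrix ι ι ℝ) :
    ∑ i, ∑ j, (A * B - B * A) i j ^ 2 ≤
      2 * (∑ i, ∑ j, A i j ^ 2) * ∑ i, ∑ j, B i j ^ 2 := by
  obtain ⟨U, d, hU, hd⟩ := exists_orthogonal_conj_eq_diagonal hA
  have hmul (X Y : Matrix ι ι ℝ) : Uᵀ * (X * Y) * U = Uᵀ * X * U * (Uᵀ * Y * U) := by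
    calc Uᵀ * (X * Y) * U = Uᵀ * X * 1 * Y * U := by
          simp only [Matrix.mul_one, Matrix.mul_assoc]
      _ = Uᵀ * X * U * (Uᵀ * Y * U) := by simp only [← hU, Matrix.mul_assoc]
  have hcomm : Uᵀ * (A * B - B * A) * U =
      diagonal d * (Uᵀ * B * U) - Uᵀ * B * U * diagonal d := by
    rw [Matrix.mul_sub, Matrix.sub_mul, hmul, hmul, hd]
  have hdiag : ∑ i, ∑ j, A i j ^ 2 = ∑ i, d i ^ 2 := by
    rw [← sum_sq_entries_orthogonal_conj hU A, hd]
    simp [Matrix.diagonal_apply, ite_pow]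
  rw [← sum_sq_entries_orthogonal_conj hU (A * B - B * A), hcomm, hdiag,
    ← sum_sq_entries_orthogonal_conj hU B]
  exact sum_sq_commutator_diagonal_le d _

theorem ddvv_matrix_inequality_codimension_two
    (n : ℕ) (hn : 0 < n)
    (A B : Matrix (Fin n) (Fin n) ℝ) (hA : A.IsSymm) (hB : B.IsSymm) :
    ((∑ i, ∑ j, (A i j) ^ 2) + ∑ i, ∑ j, (B i j) ^ 2) ^ 2 ≥
      2 * ∑ i, ∑ j, ((A * B - B * A) i j) ^ 2 := by
  have h := sum_sq_commutator_le_of_isSymm hA B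
  linarith [sq_nonneg ((∑ i, ∑ j, A i j ^ 2) - ∑ i, ∑ j, B i j ^ 2)]
end
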